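/- For each fixed integer j ≥ 1 there exists a constant C_j > 0 such that for all integers n ≥ j: |φ_{n,j} − α_j/(n+2)| ≤ C_j/(n+2)^3 and |λ_{n,j} − α_j^4/(n+2)^4| ≤ C_j/(n+2)^6. -/

import Mathlib

open Real Set Filter Topology

/-- The symbol `g(x) = (2 sin(x/2))^4`. -/
noncomputable def g (x : ℝ) : ℝ := (2 * Real.sin (x / 2)) ^ 4

/-- The `n × n` pentadiagonal Toeplitz matrix generated by `g`. -/
noncomputable def T (n : ℕ) : Matrix (Fin n) (Fin n) ℝ :=
  Matrix.of fun j k =>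
    if ((j : ℤ) - (k : ℤ)) = 0 then 6
    else if ((j : ℤ) - (k : ℤ)) = 1 ∨ ((j : ℤ) - (k : ℤ)) = -1 then -4
    else if ((j : ℤ) - (k : ℤ)) = 2 ∨ ((j : ℤ) - (k : ℤ)) = -2 then 1
    else 0

lemma sum_ite_shift (n : ℕ) (W : ℤ → ℝ) (m : ℤ) (h : 0 ≤ m ∧ m < n ∨ W m = 0) :
    ∑ k : Fin n, (if (k : ℤ) = m then W k else 0) = W m := by
  by_cases hm : 0 ≤ m ∧ m < n
  · obtain ⟨h0, h1⟩ := hm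
    rw [Finset.sum_eq_single (⟨m.toNat, by omega⟩ : Fin n)]
    · simp [h0]
    · intro b _ hb
      rw [if_neg]
      intro hbm
      apply hb
      ext
      simp only
      omega
    · simp
  · have hW : W m = 0 := by tauto
    rw [hW]
    refine Finset.sum_eq_zero fun k _ => ?_
    rw [if_neg]
    have := k.2
    omega

lemma T_mulVec (n : ℕ) (W : ℤ → ℝ) (h1 : W (-2) = 0) (h2 : W (-1) = 0)
    (h3 : W n = 0) (h4 : W (n + 1) = 0) (i : Fin n) :
    (T n).mulVec (fun k => W k) i =
      W (i - 2) - 4 * W (i - 1) + 6 * W i - 4 * W (i + 1) + W (i + 2) := by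
  have hi := i.2
  have key : ∀ m : ℤ, -2 ≤ m → m ≤ n + 1 → 0 ≤ m ∧ m < n ∨ W m = 0 := by
    intro m hm hm'
    by_cases hc : 0 ≤ m ∧ m < n
    · exact Or.inl hc
    · right
      have : m = -2 ∨ m = -1 ∨ m = n ∨ m = n + 1 := by omega
      rcases this with rfl | rfl | rfl | rfl <;> assumption
  rw [← sum_ite_shift n W (i - 2) (key _ (by omega) (by omega)),
    ← sum_ite_shift n W (i - 1) (key _ (by omega) (by omega)),
    ← sum_ite_shift n W i (key _ (by omega) (by omega)),
    ← sum_ite_shift n W (i + 1) (key _ (by omega) (by omega)),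
    ← sum_ite_shift n W (i + 2) (key _ (by omega) (by omega))]
  simp only [Matrix.mulVec, dotProduct, Finset.mul_sum, ← Finset.sum_sub_distrib,
    ← Finset.sum_add_distrib]
  refine Finset.sum_congr rfl fun k _ => ?_
  simp only [T, Matrix.of_apply]
  split_ifs <;> first | omega | ring

lemma mem_spectrum_of_mulVec {n : ℕ} (A : Matrix (Fin n) (Fin n) ℝ) (μ : ℝ) (v : Fin n → ℝ)
    (hv : v ≠ 0) (h : A.mulVec v = μ • v) : μ ∈ spectrum ℝ A := by
  rw [← Matrix.spectrum_toLin', ← Module.End.hasEigenvalue_iff_mem_spectrum]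
  refine Module.End.hasEigenvalue_of_hasEigenvector (x := v) ⟨?_, hv⟩
  rw [Module.End.mem_eigenspace_iff, Matrix.toLin'_apply, h]

/-- A combination of solutions of `2 p k - p (k+1) - p (k-1) = ± μ p k` satisfying the boundary
conditions gives an eigenvector of `T n` for the eigenvalue `μ ^ 2`. -/
lemma sq_mem_spectrum (n : ℕ) (μ : ℝ) (hμ : μ ≠ 0) (p q : ℤ → ℝ)
    (hp : ∀ k, p (k + 1) + p (k - 1) = (2 - μ) * p k)
    (hq : ∀ k, q (k + 1) + q (k - 1) = (2 + μ) * q k)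
    (h1 : p (-2) + q (-2) = 0) (h2 : p (-1) + q (-1) = 0)
    (h3 : p n + q n = 0) (h4 : p (n + 1) + q (n + 1) = 0)
    (hne : ¬ (p n = 0 ∧ p (n - 1) = 0)) (hn : 1 ≤ n) : μ ^ 2 ∈ spectrum ℝ (T n) := by
  refine mem_spectrum_of_mulVec _ _ (fun k => p k + q k) ?_ ?_
  · intro h0
    have hz : ∀ m : ℤ, -2 ≤ m → m ≤ n + 1 → p m + q m = 0 := by
      intro m hm hm'
      by_cases hc : 0 ≤ m ∧ m < n
      · have := congrFun h0 ⟨m.toNat, by omega⟩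
        simpa [hc.1] using this
      · have : m = -2 ∨ m = -1 ∨ m = n ∨ m = n + 1 := by omega
        rcases this with rfl | rfl | rfl | rfl <;> assumption
    have hpz : ∀ m : ℤ, -1 ≤ m → m ≤ n → p m = 0 := by
      intro m hm hm'
      have e1 := hz (m + 1) (by omega) (by omega)
      have e2 := hz (m - 1) (by omega) (by omega)
      have e3 := hz m (by omega) (by omega)
      have : μ * p m = 0 := by linear_combination (hp m + hq m - e1 - e2) / 2 + (2 + μ) / 2 * e3
      exact (mul_eq_zero.1 this).resolve_left hμ
    exact hne ⟨hpz n (by omega) le_rfl, hpz (n - 1) (by omega) (by omega)⟩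
  · ext i
    rw [T_mulVec n (fun k => p k + q k) h1 h2 h3 h4]
    have a1 := hp (i - 1)
    have a2 := hp i
    have a3 := hp (i + 1)
    have b1 := hq (i - 1)
    have b2 := hq i
    have b3 := hq (i + 1)
    rw [show (i : ℤ) - 1 + 1 = i by ring, show (i : ℤ) - 1 - 1 = i - 2 by ring] at a1 b1
    rw [show (i : ℤ) + 1 + 1 = i + 2 by ring, show (i : ℤ) + 1 - 1 = i by ring] at a3 b3
    simp only [Pi.smul_apply, smul_eq_mul]
    linear_combination a1 + a3 + b1 + b3 - (2 + μ) * a2 - (2 - μ) * b2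

lemma cos_recurrence (a t : ℝ) :
    Real.cos ((t + 2) * a) + Real.cos ((t - 2) * a) =
      (2 - (2 * Real.sin a) ^ 2) * Real.cos (t * a) := by
  rw [add_mul, sub_mul, Real.cos_add, Real.cos_sub, Real.cos_two_mul, Real.cos_sq']
  ring

lemma sin_recurrence (a t : ℝ) :
    Real.sin ((t + 2) * a) + Real.sin ((t - 2) * a) =
      (2 - (2 * Real.sin a) ^ 2) * Real.sin (t * a) := by
  rw [add_mul, sub_mul, Real.sin_add, Real.sin_sub, Real.cos_two_mul, Real.cos_sq']
  ring

lemma cosh_recurrence (b t : ℝ) :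
    Real.cosh ((t + 2) * b) + Real.cosh ((t - 2) * b) =
      (2 + (2 * Real.sinh b) ^ 2) * Real.cosh (t * b) := by
  rw [add_mul, sub_mul, Real.cosh_add, Real.cosh_sub, Real.cosh_two_mul, Real.cosh_sq']
  ring

lemma sinh_recurrence (b t : ℝ) :
    Real.sinh ((t + 2) * b) + Real.sinh ((t - 2) * b) =
      (2 + (2 * Real.sinh b) ^ 2) * Real.sinh (t * b) := by
  rw [add_mul, sub_mul, Real.sinh_add, Real.sinh_sub, Real.cosh_two_mul, Real.cosh_sq']
  ring

/-- Characteristic function of the symmetric eigenvectors, in terms of `a = φ / 2`. -/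
noncomputable def symmChar (N a : ℝ) : ℝ :=
  Real.sin (N * a) * Real.cosh (N * Real.arsinh (Real.sin a)) * Real.cosh (Real.arsinh (Real.sin a))
    + Real.cos (N * a) * Real.sinh (N * Real.arsinh (Real.sin a)) * Real.cos a

/-- Characteristic function of the antisymmetric eigenvectors, in terms of `a = φ / 2`. -/
noncomputable def antiChar (N a : ℝ) : ℝ :=
  Real.sin (N * a) * Real.cosh (N * Real.arsinh (Real.sin a)) * Real.cos a
    - Real.cos (N * a) * Real.sinh (N * Real.arsinh (Real.sin a))
      * Real.cosh (Real.arsinh (Real.sin a))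

lemma mem_spectrum_of_symmChar (n : ℕ) (hn : 1 ≤ n) (a : ℝ) (ha : 0 < a) (ha' : a < π / 2)
    (h : symmChar (n + 2) a = 0) : ((2 * Real.sin a) ^ 2) ^ 2 ∈ spectrum ℝ (T n) := by
  have hs : 0 < Real.sin a := Real.sin_pos_of_pos_of_lt_pi ha (by linarith)
  have hc : 0 < Real.cos a := Real.cos_pos_of_mem_Ioo ⟨by linarith, ha'⟩
  unfold symmChar at h
  set b := Real.arsinh (Real.sin a) with hb
  have hsb : Real.sinh b = Real.sin a := Real.sinh_arsinh _
  have hbdry : Real.cos ((n + 3) * a) * Real.cosh ((n + 1) * b)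
      - Real.cos ((n + 1) * a) * Real.cosh ((n + 3) * b) = 0 := by
    rw [show ((n : ℝ) + 3) * a = (n + 2) * a + a by ring,
      show ((n : ℝ) + 1) * a = (n + 2) * a - a by ring,
      show ((n : ℝ) + 3) * b = (n + 2) * b + b by ring,
      show ((n : ℝ) + 1) * b = (n + 2) * b - b by ring,
      Real.cos_add, Real.cos_sub, Real.cosh_add, Real.cosh_sub, hsb]
    linear_combination (-2 * Real.sin a) * h
  refine sq_mem_spectrum n _ (by positivity)
    (fun k => Real.cosh ((n + 1) * b) * Real.cos ((2 * k - n + 1) * a))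
    (fun k => -(Real.cos ((n + 1) * a) * Real.cosh ((2 * k - n + 1) * b))) ?_ ?_ ?_ ?_ ?_ ?_ ?_ hn
  · intro k
    have := cos_recurrence a (2 * k - n + 1)
    push_cast
    rw [show 2 * ((k : ℝ) + 1) - n + 1 = 2 * k - n + 1 + 2 by ring,
      show 2 * ((k : ℝ) - 1) - n + 1 = 2 * k - n + 1 - 2 by ring]
    linear_combination Real.cosh ((n + 1) * b) * this
  · intro k
    have := cosh_recurrence b (2 * k - n + 1)
    rw [hsb] at this
    push_cast
    rw [show 2 * ((k : ℝ) + 1) - n + 1 = 2 * k - n + 1 + 2 by ring,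
      show 2 * ((k : ℝ) - 1) - n + 1 = 2 * k - n + 1 - 2 by ring]
    linear_combination -Real.cos ((n + 1) * a) * this
  · push_cast
    rw [show (2 * (-2) - (n : ℝ) + 1) * a = -((n + 3) * a) by ring,
      show (2 * (-2) - (n : ℝ) + 1) * b = -((n + 3) * b) by ring, Real.cos_neg, Real.cosh_neg]
    linear_combination hbdry
  · push_cast
    rw [show (2 * (-1) - (n : ℝ) + 1) * a = -((n + 1) * a) by ring,
      show (2 * (-1) - (n : ℝ) + 1) * b = -((n + 1) * b) by ring, Real.cos_neg, Real.cosh_neg]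
    ring
  · push_cast
    rw [show 2 * (n : ℝ) - n + 1 = n + 1 by ring]
    ring
  · push_cast
    rw [show 2 * ((n : ℝ) + 1) - n + 1 = n + 3 by ring]
    linear_combination hbdry
  · rintro ⟨e1, e2⟩
    push_cast at e1 e2
    have hch := (Real.cosh_pos ((n + 1) * b)).ne'
    rw [show 2 * (n : ℝ) - n + 1 = n + 1 by ring] at e1
    rw [show (2 * ((n : ℝ) - 1) - n + 1) * a = (n + 1) * a - 2 * a by ring, Real.cos_sub,
      Real.sin_two_mul] at e2
    have e1 := (mul_eq_zero.1 e1).resolve_left hch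
    have e2 := (mul_eq_zero.1 e2).resolve_left hch
    rw [e1] at e2
    have e3 : Real.sin ((n + 1) * a) = 0 := by
      have : Real.sin ((n + 1) * a) * (2 * Real.sin a * Real.cos a) = 0 := by
        linear_combination e2
      exact (mul_eq_zero.1 this).resolve_right (by positivity)
    have := Real.sin_sq_add_cos_sq ((n + 1) * a)
    rw [e1, e3] at this
    norm_num at this

lemma mem_spectrum_of_antiChar (n : ℕ) (hn : 1 ≤ n) (a : ℝ) (ha : 0 < a) (ha' : a < π / 2)
    (h : antiChar (n + 2) a = 0) : ((2 * Real.sin a) ^ 2) ^ 2 ∈ spectrum ℝ (T n) := by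
  have hs : 0 < Real.sin a := Real.sin_pos_of_pos_of_lt_pi ha (by linarith)
  have hc : 0 < Real.cos a := Real.cos_pos_of_mem_Ioo ⟨by linarith, ha'⟩
  unfold antiChar at h
  set b := Real.arsinh (Real.sin a) with hb
  have hbpos : 0 < b := Real.arsinh_pos_iff.2 hs
  have hsb : Real.sinh b = Real.sin a := Real.sinh_arsinh _
  have hbdry : Real.sin ((n + 3) * a) * Real.sinh ((n + 1) * b)
      - Real.sin ((n + 1) * a) * Real.sinh ((n + 3) * b) = 0 := by
    rw [show ((n : ℝ) + 3) * a = (n + 2) * a + a by ring,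
      show ((n : ℝ) + 1) * a = (n + 2) * a - a by ring,
      show ((n : ℝ) + 3) * b = (n + 2) * b + b by ring,
      show ((n : ℝ) + 1) * b = (n + 2) * b - b by ring,
      Real.sin_add, Real.sin_sub, Real.sinh_add, Real.sinh_sub, hsb]
    linear_combination (-2 * Real.sin a) * h
  refine sq_mem_spectrum n _ (by positivity)
    (fun k => Real.sinh ((n + 1) * b) * Real.sin ((2 * k - n + 1) * a))
    (fun k => -(Real.sin ((n + 1) * a) * Real.sinh ((2 * k - n + 1) * b))) ?_ ?_ ?_ ?_ ?_ ?_ ?_ hn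
  · intro k
    have := sin_recurrence a (2 * k - n + 1)
    push_cast
    rw [show 2 * ((k : ℝ) + 1) - n + 1 = 2 * k - n + 1 + 2 by ring,
      show 2 * ((k : ℝ) - 1) - n + 1 = 2 * k - n + 1 - 2 by ring]
    linear_combination Real.sinh ((n + 1) * b) * this
  · intro k
    have := sinh_recurrence b (2 * k - n + 1)
    rw [hsb] at this
    push_cast
    rw [show 2 * ((k : ℝ) + 1) - n + 1 = 2 * k - n + 1 + 2 by ring,
      show 2 * ((k : ℝ) - 1) - n + 1 = 2 * k - n + 1 - 2 by ring]
    linear_combination -Real.sin ((n + 1) * a) * this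
  · push_cast
    rw [show (2 * (-2) - (n : ℝ) + 1) * a = -((n + 3) * a) by ring,
      show (2 * (-2) - (n : ℝ) + 1) * b = -((n + 3) * b) by ring, Real.sin_neg, Real.sinh_neg]
    linear_combination -hbdry
  · push_cast
    rw [show (2 * (-1) - (n : ℝ) + 1) * a = -((n + 1) * a) by ring,
      show (2 * (-1) - (n : ℝ) + 1) * b = -((n + 1) * b) by ring, Real.sin_neg, Real.sinh_neg]
    ring
  · push_cast
    rw [show 2 * (n : ℝ) - n + 1 = n + 1 by ring]
    ring
  · push_cast
    rw [show 2 * ((n : ℝ) + 1) - n + 1 = n + 3 by ring]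
    linear_combination hbdry
  · rintro ⟨e1, e2⟩
    push_cast at e1 e2
    have hsh : Real.sinh ((n + 1) * b) ≠ 0 := (Real.sinh_pos_iff.2 (by positivity)).ne'
    rw [show 2 * (n : ℝ) - n + 1 = n + 1 by ring] at e1
    rw [show (2 * ((n : ℝ) - 1) - n + 1) * a = (n + 1) * a - 2 * a by ring, Real.sin_sub,
      Real.sin_two_mul] at e2
    have e1 := (mul_eq_zero.1 e1).resolve_left hsh
    have e2 := (mul_eq_zero.1 e2).resolve_left hsh
    rw [e1] at e2
    have e3 : Real.cos ((n + 1) * a) = 0 := by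
      have : Real.cos ((n + 1) * a) * (2 * Real.sin a * Real.cos a) = 0 := by
        linear_combination -e2
      exact (mul_eq_zero.1 this).resolve_right (by positivity)
    have := Real.sin_sq_add_cos_sq ((n + 1) * a)
    rw [e1, e3] at this
    norm_num at this

lemma exists_zero_of_mul_neg {f : ℝ → ℝ} (hf : Continuous f) {x y : ℝ} (hxy : x ≤ y)
    (h : f x * f y < 0) : ∃ c ∈ Set.Ioo x y, f c = 0 := by
  rcases mul_neg_iff.1 h with h | h
  · exact intermediate_value_Ioo' hxy hf.continuousOn ⟨h.2, h.1⟩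
  · exact intermediate_value_Ioo hxy hf.continuousOn ⟨h.1, h.2⟩

lemma continuous_symmChar (N : ℝ) : Continuous (symmChar N) := by
  have := Real.continuous_arsinh
  unfold symmChar
  fun_prop

lemma continuous_antiChar (N : ℝ) : Continuous (antiChar N) := by
  have := Real.continuous_arsinh
  unfold antiChar
  fun_prop

lemma exists_antiChar_eq_zero (N : ℝ) (m : ℕ) (hm : 1 ≤ m) (hN : 2 * (m : ℝ) + 1 < N) :
    ∃ a ∈ Set.Ioo (m * π / N) ((m * π + π / 2) / N), antiChar N a = 0 := by
  have hπ := Real.pi_pos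
  have hm' : (1 : ℝ) ≤ m := by exact_mod_cast hm
  have hN0 : 0 < N := by linarith
  have hlt : m * π / N < (m * π + π / 2) / N := by gcongr; linarith
  have hx0 : 0 < m * π / N := by positivity
  have hy1 : (m * π + π / 2) / N < π / 2 := by
    rw [div_lt_iff₀ hN0]
    nlinarith
  refine exists_zero_of_mul_neg (continuous_antiChar N) hlt.le ?_
  unfold antiChar
  have pos : ∀ a, 0 < a → a < π / 2 → 0 < Real.sinh (N * Real.arsinh (Real.sin a)) := by
    intro a h0 h1
    have := Real.arsinh_pos_iff.2 (Real.sin_pos_of_pos_of_lt_pi h0 (by linarith))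
    exact Real.sinh_pos_iff.2 (by positivity)
  have p1 := pos _ hx0 (hlt.trans hy1)
  have p2 : 0 < Real.cos ((m * π + π / 2) / N) :=
    Real.cos_pos_of_mem_Ioo ⟨by linarith [hx0.trans hlt], hy1⟩
  rw [mul_div_cancel₀ _ hN0.ne', mul_div_cancel₀ _ hN0.ne', Real.sin_add_pi_div_two,
    Real.cos_add_pi_div_two, Real.sin_nat_mul_pi, Real.cos_nat_mul_pi]
  have p3 := Real.cosh_pos (Real.arsinh (Real.sin (m * π / N)))
  have p4 := Real.cosh_pos (N * Real.arsinh (Real.sin ((m * π + π / 2) / N)))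
  have hsq : ((-1 : ℝ) ^ m) ^ 2 = 1 := by rw [← pow_mul, mul_comm, pow_mul]; simp
  have hprod := mul_pos (mul_pos p1 p3) (mul_pos p4 p2)
  generalize Real.sinh (N * Real.arsinh (Real.sin (m * π / N))) = A at *
  generalize Real.cosh (Real.arsinh (Real.sin (m * π / N))) = B at *
  generalize Real.cosh (N * Real.arsinh (Real.sin ((m * π + π / 2) / N))) = C at *
  generalize Real.cos ((m * π + π / 2) / N) = D at *
  have : ((-1 : ℝ) ^ m) ^ 2 * (A * B * (C * D)) > 0 := by rw [hsq]; linarith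
  nlinarith

lemma exists_symmChar_eq_zero (N : ℝ) (m : ℕ) (hN : 2 * (m : ℝ) + 2 < N) :
    ∃ a ∈ Set.Ioo ((m * π + π / 2) / N) ((m * π + π) / N), symmChar N a = 0 := by
  have hπ := Real.pi_pos
  have hm' : (0 : ℝ) ≤ m := by positivity
  have hN0 : 0 < N := by linarith
  have hlt : (m * π + π / 2) / N < (m * π + π) / N := by gcongr; linarith
  have hx0 : 0 < (m * π + π / 2) / N := by positivity
  have hy1 : (m * π + π) / N < π / 2 := by
    rw [div_lt_iff₀ hN0]
    nlinarith
  refine exists_zero_of_mul_neg (continuous_symmChar N) hlt.le ?_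
  unfold symmChar
  have pos : ∀ a, 0 < a → a < π / 2 → 0 < Real.sinh (N * Real.arsinh (Real.sin a)) := by
    intro a h0 h1
    have := Real.arsinh_pos_iff.2 (Real.sin_pos_of_pos_of_lt_pi h0 (by linarith))
    exact Real.sinh_pos_iff.2 (by positivity)
  have p1 := pos _ (hx0.trans hlt) hy1
  have p2 : 0 < Real.cos ((m * π + π) / N) :=
    Real.cos_pos_of_mem_Ioo ⟨by linarith [hx0.trans hlt], hy1⟩
  rw [mul_div_cancel₀ _ hN0.ne', mul_div_cancel₀ _ hN0.ne', Real.sin_add_pi_div_two,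
    Real.cos_add_pi_div_two, Real.sin_add_pi, Real.cos_add_pi, Real.sin_nat_mul_pi,
    Real.cos_nat_mul_pi]
  have p3 := Real.cosh_pos (Real.arsinh (Real.sin ((m * π + π / 2) / N)))
  have p4 := Real.cosh_pos (N * Real.arsinh (Real.sin ((m * π + π / 2) / N)))
  have hsq : ((-1 : ℝ) ^ m) ^ 2 = 1 := by rw [← pow_mul, mul_comm, pow_mul]; simp
  have hprod := mul_pos (mul_pos p1 p2) (mul_pos p4 p3)
  generalize Real.sinh (N * Real.arsinh (Real.sin ((m * π + π) / N))) = A at *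
  generalize Real.cosh (Real.arsinh (Real.sin ((m * π + π / 2) / N))) = B at *
  generalize Real.cosh (N * Real.arsinh (Real.sin ((m * π + π / 2) / N))) = C at *
  generalize Real.cos ((m * π + π) / N) = D at *
  have : ((-1 : ℝ) ^ m) ^ 2 * (A * D * (C * B)) > 0 := by rw [hsq]; linarith
  nlinarith

/-- Characteristic function of the `i`-th eigenvector. -/
noncomputable def slotChar (i : ℕ) : ℝ → ℝ → ℝ := if Even i then antiChar else symmChar

lemma exists_slotChar_eq_zero (N : ℝ) (i : ℕ) (hi : 1 ≤ i) (hN : (i : ℝ) + 1 < N) :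
    ∃ a ∈ Set.Ioo (i * π / (2 * N)) ((i + 1) * π / (2 * N)), slotChar i N a = 0 := by
  have hN0 : N ≠ 0 := by
    have : (0 : ℝ) ≤ i := by positivity
    linarith
  unfold slotChar
  rcases Nat.even_or_odd' i with ⟨m, rfl | rfl⟩
  · rw [if_pos (even_two_mul m)]
    push_cast at hN ⊢
    convert exists_antiChar_eq_zero N m (by omega) hN using 5
    · field_simp
    · field_simp
  · rw [if_neg (by simp)]
    push_cast at hN ⊢
    convert exists_symmChar_eq_zero N m (by linarith) using 5
    · field_simp
    · field_simp; ring

lemma pi_slot_le {N : ℝ} {i : ℕ} (hN : (i : ℝ) + 1 < N) : (i + 1) * π / (2 * N) ≤ π / 2 := by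
  have : (0 : ℝ) ≤ i := by positivity
  rw [div_le_div_iff₀ (by linarith) two_pos]
  nlinarith [Real.pi_pos]

lemma mem_spectrum_of_slotChar (n i : ℕ) (hn : 1 ≤ n) (a : ℝ) (ha : 0 < a) (ha' : a < π / 2)
    (h : slotChar i (n + 2) a = 0) : g (2 * a) ∈ spectrum ℝ (T n) := by
  have e : g (2 * a) = ((2 * Real.sin a) ^ 2) ^ 2 := by
    unfold g
    rw [mul_div_cancel_left₀ _ two_ne_zero]
    ring
  rw [e]
  unfold slotChar at h
  split_ifs at h
  · exact mem_spectrum_of_antiChar n hn a ha ha' h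
  · exact mem_spectrum_of_symmChar n hn a ha ha' h

lemma g_strictMonoOn : StrictMonoOn g (Set.Icc 0 π) := by
  intro x hx y hy hxy
  unfold g
  have h0 : 0 ≤ Real.sin (x / 2) :=
    Real.sin_nonneg_of_nonneg_of_le_pi (by linarith [hx.1]) (by linarith [hx.2, hx.1])
  have : Real.sin (x / 2) < Real.sin (y / 2) :=
    Real.strictMonoOn_sin ⟨by linarith [hx.1, Real.pi_pos], by linarith [hx.2]⟩
      ⟨by linarith [hy.1, Real.pi_pos], by linarith [hy.2]⟩ (by linarith)
  gcongr

/-- A matrix of size `n` has at most one increasing family of `n` eigenvalues. -/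
lemma strictMono_eigenvalues_unique {n : ℕ} (A : Matrix (Fin n) (Fin n) ℝ) {u v : Fin n → ℝ}
    (hu : StrictMono u) (hv : StrictMono v) (hu' : ∀ i, u i ∈ spectrum ℝ A)
    (hv' : ∀ i, v i ∈ spectrum ℝ A) : u = v := by
  have hroot : ∀ x ∈ spectrum ℝ A, x ∈ A.charpoly.roots.toFinset := by
    intro x hx
    rw [Multiset.mem_toFinset, Polynomial.mem_roots (Matrix.charpoly_monic A).ne_zero]
    exact Matrix.mem_spectrum_iff_isRoot_charpoly.1 hx
  have hle : A.charpoly.roots.toFinset.card ≤ n := by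
    refine (Multiset.toFinset_card_le _).trans ((Polynomial.card_roots' _).trans ?_)
    rw [Matrix.charpoly_natDegree_eq_dim, Fintype.card_fin]
  have hge : n ≤ A.charpoly.roots.toFinset.card := by
    have := Finset.card_le_card_of_injOn (s := Finset.univ) u
      (fun i _ => hroot _ (hu' i)) hu.injective.injOn
    simpa using this
  have hcard := le_antisymm hle hge
  rw [Finset.orderEmbOfFin_unique hcard (fun i => hroot _ (hu' i)) hu,
    Finset.orderEmbOfFin_unique hcard (fun i => hroot _ (hv' i)) hv]

lemma exists_slot_of_eigenvalue (n : ℕ) (lam : ℕ → ℝ)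
    (hmono : ∀ j k, 1 ≤ j → j < k → k ≤ n → lam j < lam k)
    (hspec : ∀ j, 1 ≤ j → j ≤ n → lam j ∈ spectrum ℝ (T n)) (j : ℕ) (hj : 1 ≤ j) (hjn : j ≤ n) :
    ∃ a ∈ Set.Ioo (j * π / (2 * ((n : ℝ) + 2))) ((j + 1) * π / (2 * ((n : ℝ) + 2))),
      slotChar j (n + 2) a = 0 ∧ g (2 * a) = lam j := by
  have hex : ∀ i : Fin n, ∃ a ∈ Set.Ioo (((i + 1 : ℕ) : ℝ) * π / (2 * ((n : ℝ) + 2)))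
      ((((i + 1 : ℕ) : ℝ) + 1) * π / (2 * ((n : ℝ) + 2))), slotChar (i + 1) (n + 2) a = 0 := by
    intro i
    refine exists_slotChar_eq_zero _ _ (by omega) ?_
    have : ((i + 1 : ℕ) : ℝ) ≤ n := by exact_mod_cast i.2
    linarith
  choose a ha haz using hex
  have hpos : ∀ i, 0 < a i := fun i => lt_of_le_of_lt (by positivity) (ha i).1
  have hlt : ∀ i, a i < π / 2 := fun i => (ha i).2.trans_le <| pi_slot_le <| by
    have : ((i + 1 : ℕ) : ℝ) ≤ n := by exact_mod_cast i.2
    linarith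
  have hamono : StrictMono a := by
    intro i k hik
    refine (ha i).2.trans_le (le_trans ?_ (ha k).1.le)
    have : ((i + 1 : ℕ) : ℝ) + 1 ≤ ((k + 1 : ℕ) : ℝ) := by
      have : (i : ℕ) + 1 ≤ k := hik
      exact_mod_cast Nat.succ_le_succ this
    gcongr
  have heq : (fun i => g (2 * a i)) = fun i : Fin n => lam (i + 1) := by
    refine strictMono_eigenvalues_unique (T n) ?_ ?_ ?_ ?_
    · intro i k hik
      exact g_strictMonoOn ⟨by linarith [hpos i], by linarith [hlt i]⟩
        ⟨by linarith [hpos k], by linarith [hlt k]⟩ (by linarith [hamono hik])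
    · intro i k hik
      exact hmono _ _ (by omega) (Nat.succ_lt_succ hik) (by omega)
    · intro i
      exact mem_spectrum_of_slotChar n _ (hj.trans hjn) _ (hpos i) (hlt i) (haz i)
    · intro i
      exact hspec _ (by omega) (by omega)
  have hidx : ((⟨j - 1, by omega⟩ : Fin n) : ℕ) + 1 = j := by simp only; omega
  refine ⟨a ⟨j - 1, by omega⟩, ?_, ?_, ?_⟩
  · simpa only [hidx] using ha ⟨j - 1, by omega⟩
  · simpa only [hidx] using haz ⟨j - 1, by omega⟩
  · simpa only [hidx] using congrFun heq ⟨j - 1, by omega⟩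

lemma hasDerivAt_real_tanh (x : ℝ) : HasDerivAt Real.tanh (1 / Real.cosh x ^ 2) x := by
  have h := (Real.hasDerivAt_sinh x).div (Real.hasDerivAt_cosh x) (Real.cosh_pos x).ne'
  have e : Real.tanh = Real.sinh / Real.cosh := by
    ext y
    exact Real.tanh_eq_sinh_div_cosh y
  rw [e]
  refine h.congr_deriv ?_
  congr 1
  linear_combination Real.cosh_sq x

lemma abs_tanh_sub_tanh_le (x y : ℝ) : |Real.tanh x - Real.tanh y| ≤ |x - y| := by
  have := Convex.norm_image_sub_le_of_norm_hasDerivWithin_le (s := Set.univ) (C := 1)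
    (fun z _ => (hasDerivAt_real_tanh z).hasDerivWithinAt) (fun z _ => ?_) convex_univ
    (Set.mem_univ y) (Set.mem_univ x)
  · simpa using this
  · rw [Real.norm_of_nonneg (by positivity)]
    exact div_le_one_of_le₀ (one_le_pow₀ (Real.one_le_cosh z)) (by positivity)

lemma abs_tanh_sub_tanh_le_half {x y : ℝ} (hx : 1 ≤ x) (hy : 1 ≤ y) :
    |Real.tanh x - Real.tanh y| ≤ 1 / 2 * |x - y| := by
  refine Convex.norm_image_sub_le_of_norm_hasDerivWithin_le (s := Set.Ici 1)
    (fun z _ => (hasDerivAt_real_tanh z).hasDerivWithinAt) (fun z hz => ?_) (convex_Ici 1) hy hx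
  rw [Real.norm_of_nonneg (by positivity)]
  have h1 : (1 : ℝ) ≤ z := hz
  have h2 : z ≤ Real.sinh z := Real.self_le_sinh_iff.2 (by linarith)
  have h3 := Real.cosh_sq z
  exact one_div_le_one_div_of_le two_pos (by nlinarith)

lemma cos_ne_zero_of_mem_slot {j : ℕ} {x : ℝ}
    (hx : x ∈ Set.Ioo (j * π / 2) ((j + 1) * π / 2)) : Real.cos x ≠ 0 := by
  intro h
  obtain ⟨k, rfl⟩ := Real.cos_eq_zero_iff.1 h
  have hπ := Real.pi_pos
  have h1 : ((j : ℤ) : ℝ) < ((2 * k + 1 : ℤ) : ℝ) := by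
    push_cast
    nlinarith [hx.1]
  have h2 : ((2 * k + 1 : ℤ) : ℝ) < ((j + 1 : ℤ) : ℝ) := by
    push_cast
    nlinarith [hx.2]
  have h1 := Int.cast_lt.1 h1
  have h2 := Int.cast_lt.1 h2
  omega

lemma abs_sub_le_abs_tan_sub_tan {j : ℕ} {x y : ℝ}
    (hx : x ∈ Set.Ioo (j * π / 2) ((j + 1) * π / 2))
    (hy : y ∈ Set.Ioo (j * π / 2) ((j + 1) * π / 2)) :
    |x - y| ≤ |Real.tan x - Real.tan y| := by
  wlog hxy : y ≤ x generalizing x y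
  · rw [abs_sub_comm x, abs_sub_comm (Real.tan x)]
    exact this hy hx (le_of_not_ge hxy)
  have hd : ∀ z ∈ Set.Ioo (j * π / 2) ((j + 1) * π / 2),
      HasDerivAt Real.tan (1 / Real.cos z ^ 2) z :=
    fun z hz => Real.hasDerivAt_tan (cos_ne_zero_of_mem_slot hz)
  have := Convex.mul_sub_le_image_sub_of_le_deriv (convex_Ioo (j * π / 2) ((j + 1) * π / 2))
    (fun z hz => (hd z hz).continuousAt.continuousWithinAt)
    (C := 1) (f := Real.tan) (fun z hz => ?_) (fun z hz => ?_) y hy x hx hxy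
  · rw [abs_of_nonneg (sub_nonneg.2 hxy)]
    exact le_trans (by linarith) (le_abs_self _)
  · rw [interior_Ioo] at hz
    exact (hd z hz).differentiableAt.differentiableWithinAt
  · rw [interior_Ioo] at hz
    rw [(hd z hz).deriv]
    have h0 : 0 < Real.cos z ^ 2 := by
      have := cos_ne_zero_of_mem_slot hz
      positivity
    rw [le_div_iff₀ h0]
    linarith [Real.cos_sq_le_one z]

section SmallAngle

variable {a K : ℝ}

lemma cosh_arsinh_sub_cos_mem (ha : 0 < a) (ha' : a < π / 2) :
    Real.cosh (Real.arsinh (Real.sin a)) - Real.cos a ∈ Set.Icc 0 (2 * a ^ 2) := by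
  have hs : 0 < Real.sin a := Real.sin_pos_of_pos_of_lt_pi ha (by linarith)
  have hc : 0 < Real.cos a := Real.cos_pos_of_mem_Ioo ⟨by linarith, ha'⟩
  have hsa : Real.sin a ≤ a := Real.sin_le ha.le
  have h1 := Real.one_le_cosh (Real.arsinh (Real.sin a))
  have h2 := Real.cosh_sq (Real.arsinh (Real.sin a))
  rw [Real.sinh_arsinh] at h2
  have h3 := Real.sin_sq_add_cos_sq a
  have h4 := Real.cos_le_one a
  refine ⟨by linarith, ?_⟩
  have h5 : (Real.cosh (Real.arsinh (Real.sin a)) - Real.cos a)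
      * (Real.cosh (Real.arsinh (Real.sin a)) + Real.cos a) = 2 * Real.sin a ^ 2 := by
    linear_combination h2 - h3
  nlinarith

lemma abs_cosh_div_cos_sub_one_le (ha : 0 < a) (ha' : a < π / 2) (hK : 1 ≤ K * Real.cos a) :
    |Real.cosh (Real.arsinh (Real.sin a)) / Real.cos a - 1| ≤ 2 * K * a ^ 2 := by
  have hc : 0 < Real.cos a := Real.cos_pos_of_mem_Ioo ⟨by linarith, ha'⟩
  have h := cosh_arsinh_sub_cos_mem ha ha'
  rw [div_sub_one hc.ne', abs_of_nonneg (div_nonneg h.1 hc.le), div_le_iff₀ hc]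
  nlinarith [h.2, sq_nonneg a]

lemma abs_cos_div_cosh_sub_one_le (ha : 0 < a) (ha' : a < π / 2) (hK : 1 ≤ K * Real.cos a) :
    |Real.cos a / Real.cosh (Real.arsinh (Real.sin a)) - 1| ≤ 2 * K * a ^ 2 := by
  have hc : 0 < Real.cos a := Real.cos_pos_of_mem_Ioo ⟨by linarith, ha'⟩
  have h := cosh_arsinh_sub_cos_mem ha ha'
  have h1 := Real.one_le_cosh (Real.arsinh (Real.sin a))
  have hK1 : 1 ≤ K := by nlinarith [Real.cos_le_one a]
  have hch := Real.cosh_pos (Real.arsinh (Real.sin a))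
  rw [div_sub_one hch.ne', abs_div, abs_of_pos hch, abs_sub_comm, abs_of_nonneg h.1,
    div_le_iff₀ hch]
  have h2 : 2 * a ^ 2 ≤ 2 * K * a ^ 2 := by nlinarith [sq_nonneg a]
  nlinarith [h.2, sq_nonneg a]

lemma arsinh_sin_le_sin (ha : 0 < a) (ha' : a < π / 2) :
    Real.arsinh (Real.sin a) ≤ Real.sin a := by
  have hs : 0 < Real.sin a := Real.sin_pos_of_pos_of_lt_pi ha (by linarith)
  simpa [Real.sinh_arsinh] using Real.self_le_sinh_iff.2 (Real.arsinh_pos_iff.2 hs).le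

lemma sub_arsinh_sin_le (ha : 0 < a) (ha' : a < π / 2) (hK : 1 ≤ K * Real.cos a) :
    a - Real.arsinh (Real.sin a) ≤ 2 * K * a ^ 3 := by
  have hs : 0 < Real.sin a := Real.sin_pos_of_pos_of_lt_pi ha (by linarith)
  have hc : 0 < Real.cos a := Real.cos_pos_of_mem_Ioo ⟨by linarith, ha'⟩
  have hsa : Real.sin a ≤ a := Real.sin_le ha.le
  have hb := Real.arsinh_pos_iff.2 hs
  have h1 : Real.tanh (Real.arsinh (Real.sin a)) ≤ Real.arsinh (Real.sin a) := by
    have := abs_tanh_sub_tanh_le (Real.arsinh (Real.sin a)) 0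
    rw [Real.tanh_zero, sub_zero, sub_zero, abs_of_pos hb] at this
    exact (le_abs_self _).trans this
  rw [Real.tanh_eq_sinh_div_cosh, Real.sinh_arsinh] at h1
  have h2 : a ≤ Real.tan a := Real.le_tan ha.le ha'
  rw [Real.tan_eq_sin_div_cos] at h2
  have hD := cosh_arsinh_sub_cos_mem ha ha'
  have hch1 := Real.one_le_cosh (Real.arsinh (Real.sin a))
  set C := Real.cosh (Real.arsinh (Real.sin a))
  have h3 : Real.sin a / Real.cos a - Real.sin a / C ≤ 2 * K * a ^ 3 := by
    rw [div_sub_div _ _ hc.ne' (by positivity), div_le_iff₀ (by positivity)]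
    have e1 : Real.sin a * C - Real.cos a * Real.sin a = Real.sin a * (C - Real.cos a) := by ring
    have e2 : Real.sin a * (C - Real.cos a) ≤ a * (2 * a ^ 2) :=
      mul_le_mul hsa hD.2 hD.1 ha.le
    have e3 : 1 ≤ K * Real.cos a * C := by nlinarith
    have e4 : 2 * a ^ 3 * 1 ≤ 2 * a ^ 3 * (K * Real.cos a * C) := by gcongr
    nlinarith
  linarith

end SmallAngle

lemma abs_tanh_le_one (x : ℝ) : |Real.tanh x| ≤ 1 := (Real.abs_tanh_lt_one x).le

/-- On a slot, a zero of the characteristic function solves a perturbation of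
`(-1) ^ j * tan x = tanh x`. -/
lemma abs_tan_sub_tanh_le {N a K : ℝ} {j : ℕ} (hN : 0 < N) (ha : 0 < a) (ha' : a < π / 2)
    (hK : 1 ≤ K * Real.cos a) (hcos : Real.cos (N * a) ≠ 0) (h : slotChar j N a = 0) :
    |(-1) ^ j * Real.tan (N * a) - Real.tanh (N * a)| ≤ 2 * K * a ^ 2 + N * (2 * K * a ^ 3) := by
  have hc : 0 < Real.cos a := Real.cos_pos_of_mem_Ioo ⟨by linarith, ha'⟩
  have hX : ∃ r, |r - 1| ≤ 2 * K * a ^ 2 ∧ (-1) ^ j * Real.tan (N * a)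
      = Real.tanh (N * Real.arsinh (Real.sin a)) * r := by
    have hchB := Real.cosh_pos (N * Real.arsinh (Real.sin a))
    have hchb := Real.cosh_pos (Real.arsinh (Real.sin a))
    unfold slotChar at h
    rw [Real.tan_eq_sin_div_cos, Real.tanh_eq_sinh_div_cosh]
    split_ifs at h with he
    · refine ⟨_, abs_cosh_div_cos_sub_one_le ha ha' hK, ?_⟩
      rw [he.neg_one_pow, one_mul, div_mul_div_comm, div_eq_div_iff hcos (by positivity)]
      unfold antiChar at h
      linear_combination h
    · refine ⟨_, abs_cos_div_cosh_sub_one_le ha ha' hK, ?_⟩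
      rw [(Nat.not_even_iff_odd.1 he).neg_one_pow, neg_one_mul, ← neg_div, div_mul_div_comm,
        div_eq_div_iff hcos (by positivity)]
      unfold symmChar at h
      linear_combination -h
  obtain ⟨r, hr, e⟩ := hX
  rw [e]
  have h1 : |Real.tanh (N * Real.arsinh (Real.sin a)) * (r - 1)| ≤ 2 * K * a ^ 2 := by
    rw [abs_mul]
    calc _ ≤ 1 * |r - 1| := by gcongr; exact abs_tanh_le_one _
      _ ≤ _ := by linarith
  have h2 : |Real.tanh (N * Real.arsinh (Real.sin a)) - Real.tanh (N * a)|
      ≤ N * (2 * K * a ^ 3) := by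
    refine (abs_tanh_sub_tanh_le _ _).trans ?_
    rw [← mul_sub, abs_mul, abs_of_pos hN, abs_sub_comm, abs_of_nonneg]
    · gcongr
      exact sub_arsinh_sin_le ha ha' hK
    · linarith [arsinh_sin_le_sin ha ha', Real.sin_le ha.le]
  calc _ = |Real.tanh (N * Real.arsinh (Real.sin a)) * (r - 1)
        + (Real.tanh (N * Real.arsinh (Real.sin a)) - Real.tanh (N * a))| := by congr 1; ring
    _ ≤ _ := (abs_add_le _ _).trans (add_le_add h1 h2)

lemma abs_sub_le_of_slot {j : ℕ} (hj : 1 ≤ j) {x θ ε : ℝ}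
    (hx : x ∈ Set.Ioo (j * π / 2) ((j + 1) * π / 2))
    (hθ : θ ∈ Set.Ioo (j * π / 2) ((j + 1) * π / 2))
    (hθ' : Real.tanh θ = (-1) ^ j * Real.tan θ)
    (hx' : |(-1) ^ j * Real.tan x - Real.tanh x| ≤ ε) : |x - θ| ≤ 2 * ε := by
  have hj' : (1 : ℝ) ≤ j := by exact_mod_cast hj
  have h1 : 1 ≤ j * π / 2 := by nlinarith [Real.pi_gt_three]
  have h2 := abs_tanh_sub_tanh_le_half (h1.trans hx.1.le) (h1.trans hθ.1.le)
  have h3 := abs_sub_le_abs_tan_sub_tan hx hθ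
  have h4 : |Real.tan x - Real.tan θ|
      = |((-1) ^ j * Real.tan x - Real.tanh x) + (Real.tanh x - Real.tanh θ)| := by
    rw [hθ', sub_add_sub_cancel, ← mul_sub, abs_mul, abs_pow, abs_neg, abs_one, one_pow, one_mul]
  have h5 := abs_add_le ((-1) ^ j * Real.tan x - Real.tanh x) (Real.tanh x - Real.tanh θ)
  linarith

lemma abs_pow_four_sub_le {x y R δ : ℝ} (hx : |x| ≤ R) (hy : |y| ≤ R) (h : |x - y| ≤ δ) :
    |x ^ 4 - y ^ 4| ≤ δ * (4 * R ^ 3) := by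
  have hR : 0 ≤ R := (abs_nonneg x).trans hx
  have e : x ^ 4 - y ^ 4 = (x - y) * ((x + y) * (x ^ 2 + y ^ 2)) := by ring
  rw [e, abs_mul]
  have h1 : |x + y| ≤ 2 * R := (abs_add_le x y).trans (by linarith)
  have h2 : |x ^ 2 + y ^ 2| ≤ 2 * R ^ 2 := by
    rw [abs_of_nonneg (by positivity), ← sq_abs x, ← sq_abs y]
    nlinarith [abs_nonneg x, abs_nonneg y]
  have h3 : |(x + y) * (x ^ 2 + y ^ 2)| ≤ 4 * R ^ 3 := by
    rw [abs_mul]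
    calc _ ≤ 2 * R * (2 * R ^ 2) := by gcongr
      _ = _ := by ring
  exact mul_le_mul h h3 (abs_nonneg _) ((abs_nonneg _).trans h)

theorem stmt12
    (lam : ℕ → ℕ → ℝ)
    (hmono : ∀ n, 1 ≤ n → ∀ j k, 1 ≤ j → j < k → k ≤ n → lam n j < lam n k)
    (hspec : ∀ n, 1 ≤ n → ∀ j, 1 ≤ j → j ≤ n → lam n j ∈ spectrum ℝ (T n))
    (phi : ℕ → ℕ → ℝ)
    (hphi : ∀ n, 1 ≤ n → ∀ j, 1 ≤ j → j ≤ n →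
      phi n j ∈ Set.Ioo 0 Real.pi ∧ g (phi n j) = lam n j)
    (alpha : ℕ → ℝ)
    (halpha : ∀ i : ℕ, 1 ≤ i →
      alpha i ∈ Set.Ioo ((i : ℝ) * Real.pi) (((i : ℝ) + 1) * Real.pi) ∧
      Real.tanh (alpha i / 2) = (-1 : ℝ) ^ i * Real.tan (alpha i / 2))
    (j : ℕ) (hj : 1 ≤ j) :
    ∃ C : ℝ, 0 < C ∧ ∀ n : ℕ, j ≤ n →
      |phi n j - alpha j / ((n : ℝ) + 2)| ≤ C / ((n : ℝ) + 2) ^ 3 ∧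
      |lam n j - (alpha j) ^ 4 / ((n : ℝ) + 2) ^ 4| ≤ C / ((n : ℝ) + 2) ^ 6 := by
  have hπ := Real.pi_pos
  have hj' : (1 : ℝ) ≤ j := by exact_mod_cast hj
  set M : ℝ := (j + 1) * π / 2 with hM
  set K : ℝ := j + 2 with hKdef
  have hM0 : 0 < M := by positivity
  have hK0 : 0 < K := by positivity
  -- `E / N ^ 2` bounds the distance from `N * φ / 2` to `α / 2`
  set E : ℝ := 4 * K * (M ^ 2 + M ^ 3) with hE
  have hE0 : 0 < E := by positivity
  refine ⟨2 * E + (2 * E + 4 * K * M ^ 3) * (4 * (2 * M) ^ 3), by positivity, fun n hjn => ?_⟩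
  have hn : 1 ≤ n := hj.trans hjn
  obtain ⟨a, ha, hchar, hga⟩ :=
    exists_slot_of_eigenvalue n (lam n) (hmono n hn) (hspec n hn) j hj hjn
  obtain ⟨hφ, hgφ⟩ := hphi n hn j hj hjn
  obtain ⟨hα, hα'⟩ := halpha j hj
  have hjn' : (j : ℝ) ≤ n := by exact_mod_cast hjn
  set N : ℝ := n + 2 with hN
  have hN0 : 0 < N := by positivity
  have ha0 : 0 < a := lt_of_le_of_lt (by positivity) ha.1
  have ha1 : a < π / 2 := ha.2.trans_le (pi_slot_le (by linarith))
  have haM : a ≤ M / N := by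
    refine ha.2.le.trans_eq ?_
    rw [hM]
    field_simp
  have hφa : phi n j = 2 * a := by
    refine g_strictMonoOn.injOn ⟨hφ.1.le, hφ.2.le⟩ ⟨by linarith, by linarith⟩ ?_
    rw [hgφ, hga]
  have hcos : 1 ≤ K * Real.cos a := by
    have h1 := Real.one_sub_mul_le_cos ha0.le ha1.le
    have h2 : 2 / π * a ≤ (j + 1) / K := by
      calc 2 / π * a ≤ 2 / π * (M / N) := by gcongr
        _ = (j + 1) / N := by rw [hM]; field_simp
        _ ≤ (j + 1) / K := by gcongr; linarith
    have h3 : 1 - (j + 1) / K = 1 / K := by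
      rw [hKdef]; field_simp; ring
    have h4 : 1 / K ≤ Real.cos a := by linarith
    rw [div_le_iff₀ hK0] at h4
    linarith
  have hNa : N * a ∈ Set.Ioo (j * π / 2) ((j + 1) * π / 2) := by
    constructor
    · have := ha.1
      rw [div_lt_iff₀ (by positivity)] at this
      linarith
    · have := ha.2
      rw [lt_div_iff₀ (by positivity)] at this
      linarith
  have hθ : alpha j / 2 ∈ Set.Ioo (j * π / 2) ((j + 1) * π / 2) :=
    ⟨by linarith [hα.1], by linarith [hα.2]⟩
  have ha2 : a ^ 2 ≤ M ^ 2 / N ^ 2 := by rw [← div_pow]; gcongr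
  have ha3 : a ^ 3 ≤ M ^ 3 / N ^ 3 := by rw [← div_pow]; gcongr
  have hdist : |N * a - alpha j / 2| ≤ E / N ^ 2 := by
    refine (abs_sub_le_of_slot hj hNa hθ hα' (abs_tan_sub_tanh_le hN0 ha0 ha1 hcos
      (cos_ne_zero_of_mem_slot hNa) hchar)).trans ?_
    calc 2 * (2 * K * a ^ 2 + N * (2 * K * a ^ 3))
        ≤ 2 * (2 * K * (M ^ 2 / N ^ 2) + N * (2 * K * (M ^ 3 / N ^ 3))) := by gcongr
      _ = E / N ^ 2 := by rw [hE]; field_simp; ring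
  have hphi_dist : |phi n j - alpha j / N| ≤ 2 * E / N ^ 3 := by
    have e : phi n j - alpha j / N = 2 / N * (N * a - alpha j / 2) := by
      rw [hφa]; field_simp
    rw [e, abs_mul, abs_of_pos (by positivity : 0 < 2 / N)]
    calc 2 / N * |N * a - alpha j / 2| ≤ 2 / N * (E / N ^ 2) := by gcongr
      _ = _ := by field_simp
  refine ⟨hphi_dist.trans ?_, ?_⟩
  · gcongr
    have : 0 ≤ (2 * E + 4 * K * M ^ 3) * (4 * (2 * M) ^ 3) := by positivity
    linarith
  · have hs0 : 0 < Real.sin a := Real.sin_pos_of_pos_of_lt_pi ha0 (by linarith)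
    have hsa : Real.sin a ≤ a := Real.sin_le ha0.le
    have hdiff : |2 * Real.sin a - alpha j / N| ≤ (2 * E + 4 * K * M ^ 3) / N ^ 3 := by
      have h1 : |2 * Real.sin a - phi n j| ≤ 4 * K * M ^ 3 / N ^ 3 := by
        rw [hφa, abs_sub_comm, abs_of_nonneg (by linarith)]
        have := sub_arsinh_sin_le ha0 ha1 hcos
        have := arsinh_sin_le_sin ha0 ha1
        calc 2 * a - 2 * Real.sin a ≤ 4 * K * a ^ 3 := by linarith
          _ ≤ 4 * K * (M ^ 3 / N ^ 3) := by gcongr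
          _ = _ := by ring
      have h2 := abs_sub_le (2 * Real.sin a) (phi n j) (alpha j / N)
      rw [add_div]
      linarith
    have hx : |2 * Real.sin a| ≤ 2 * M / N := by
      rw [abs_of_pos (by positivity), mul_div_assoc]
      linarith
    have hy : |alpha j / N| ≤ 2 * M / N := by
      have : 0 < alpha j := lt_trans (by positivity) hα.1
      rw [abs_of_pos (by positivity)]
      gcongr
      linarith [hα.2]
    have hlam : lam n j - alpha j ^ 4 / N ^ 4 = (2 * Real.sin a) ^ 4 - (alpha j / N) ^ 4 := by
      rw [← hga, g, mul_div_cancel_left₀ _ two_ne_zero, div_pow]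
    rw [hlam]
    refine (abs_pow_four_sub_le hx hy hdiff).trans ?_
    calc (2 * E + 4 * K * M ^ 3) / N ^ 3 * (4 * (2 * M / N) ^ 3)
        = (2 * E + 4 * K * M ^ 3) * (4 * (2 * M) ^ 3) / N ^ 6 := by field_simp
      _ ≤ _ := by gcongr; linarith
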